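/- (Triangle inequality) Let X be a normal topological space and let f, g, h : X → Y be continuous maps. Then D(f, h) ≤ D(f, g) + D(g, h). -/

import Mathlib

open ContinuousMap

/-- The homotopic distance between two continuous maps `f g : C(X, Y)`:
the least `n : ℕ∞` such that `X` admits an open cover by `n + 1` sets on each of
which the restrictions of `f` and `g` are homotopic; `⊤` if no such cover exists. -/
noncomputable def homotopicDistance {X Y : Type*} [TopologicalSpace X] [TopologicalSpace Y]
    (f g : C(X, Y)) : ℕ∞ :=
  sInf ((Nat.cast : ℕ → ℕ∞) '' {n : ℕ | ∃ U : Fin (n + 1) → Set X,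
    (∀ j, IsOpen (U j)) ∧ (⋃ j, U j) = Set.univ ∧
    ∀ j, (f.restrict (U j)).Homotopic (g.restrict (U j))})

/-- The (normalized) Lusternik–Schnirelmann category of a space `X`: the least
`n : ℕ∞` such that `X` admits an open cover by `n + 1` sets on each of which the
inclusion into `X` is null-homotopic. -/
noncomputable def lsCat (X : Type*) [TopologicalSpace X] : ℕ∞ :=
  sInf ((Nat.cast : ℕ → ℕ∞) '' {n : ℕ | ∃ U : Fin (n + 1) → Set X,
    (∀ j, IsOpen (U j)) ∧ (⋃ j, U j) = Set.univ ∧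
    ∀ j, ∃ y : X, ((ContinuousMap.id X).restrict (U j)).Homotopic
      (ContinuousMap.const (U j) y)})

open Set in
/-- Homotopies on pairwise disjoint open sets glue to a homotopy on their union. -/
theorem homotopic_restrict_iUnion_of_disjoint {X Y ι : Type*} [TopologicalSpace X]
    [TopologicalSpace Y] {f g : C(X, Y)} {O : ι → Set X} (hO : ∀ i, IsOpen (O i))
    (hd : Pairwise fun i j => Disjoint (O i) (O j))
    (H : ∀ i, (f.restrict (O i)).Homotopic (g.restrict (O i))) :
    (f.restrict (⋃ i, O i)).Homotopic (g.restrict (⋃ i, O i)) := by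
  let F := fun i => (H i).some
  let S : ι → Set (unitInterval × (⋃ i, O i : Set X)) := fun i => {p | p.2.1 ∈ O i}
  let φ : ∀ i, C(S i, Y) := fun i =>
    ⟨fun p => F i (p.1.1, ⟨p.1.2.1, p.2⟩), by fun_prop⟩
  have hφ : ∀ (i j) (p) (hi : p ∈ S i) (hj : p ∈ S j), φ i ⟨p, hi⟩ = φ j ⟨p, hj⟩ := by
    intro i j p hi hj
    obtain rfl : i = j := by
      by_contra hij
      exact disjoint_left.1 (hd hij) hi hj
    rfl
  have hS : ∀ p, ∃ i, S i ∈ nhds p := by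
    intro p
    obtain ⟨i, hi⟩ := mem_iUnion.1 p.2.2
    exact ⟨i, ((hO i).preimage (by fun_prop :
      Continuous fun p : unitInterval × (⋃ i, O i : Set X) => p.2.1)).mem_nhds hi⟩
  have key : ∀ (t : unitInterval) (x : (⋃ i, O i : Set X)) (i) (hi : x.1 ∈ O i),
      ContinuousMap.liftCover S φ hφ hS (t, x) = F i (t, ⟨x.1, hi⟩) := fun t x i hi =>
    ContinuousMap.liftCover_coe (S := S) (φ := φ) (hφ := hφ) (hS := hS) (⟨(t, x), hi⟩ : S i)
  refine ⟨⟨ContinuousMap.liftCover S φ hφ hS, fun x => ?_, fun x => ?_⟩⟩ <;>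
  · obtain ⟨i, hi⟩ := mem_iUnion.1 x.2
    refine (key _ x i hi).trans ?_
    simp

/-- Restrictions of homotopic restrictions to a smaller set are homotopic. -/
theorem homotopic_restrict_mono {X Y : Type*} [TopologicalSpace X] [TopologicalSpace Y]
    {f g : C(X, Y)} {A B : Set X} (hAB : A ⊆ B)
    (H : (f.restrict B).Homotopic (g.restrict B)) :
    (f.restrict A).Homotopic (g.restrict A) :=
  H.comp (ContinuousMap.Homotopic.refl ⟨Set.inclusion hAB, continuous_inclusion hAB⟩)

open Set in
/-- A finite open cover of a normal space is subordinate to continuous functions with values in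
`[0, 1]`, at least one of which equals `1` at each point. -/
theorem exists_continuous_subordinate_eq_one {X ι : Type*} [TopologicalSpace X] [NormalSpace X]
    [Finite ι] {U : ι → Set X} (hU : ∀ i, IsOpen (U i)) (hc : ⋃ i, U i = univ) :
    ∃ φ : ι → C(X, ℝ), (∀ i x, φ i x ≤ 1) ∧ (∀ i x, 0 < φ i x → x ∈ U i) ∧
      ∀ x, ∃ i, φ i x = 1 := by
  obtain ⟨A, hA, hAc, hAU⟩ := exists_iUnion_eq_closed_subset hU (fun _ => toFinite _) hc
  choose φ h0 h1 hI using fun i => exists_continuous_zero_one_of_isClosed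
    (hU i).isClosed_compl (hAc i) (disjoint_compl_left_iff_subset.2 (hAU i))
  refine ⟨φ, fun i x => (hI i x).2, fun i x hx => ?_, fun x => ?_⟩
  · by_contra hn
    exact hx.ne' (h0 i hn)
  · obtain ⟨i, hi⟩ := mem_iUnion.1 (hA ▸ mem_univ x)
    exact ⟨i, h1 i hi⟩

/-- The points at which each function with index in `S` is positive and exceeds every function
with index outside `S`. -/
def dominantSet {X ι : Type*} [TopologicalSpace X] (θ : ι → C(X, ℝ)) (S : Finset ι) : Set X :=
  {x | ∀ s ∈ S, 0 < θ s x ∧ ∀ t ∉ S, θ t x < θ s x}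

theorem isOpen_dominantSet {X ι : Type*} [TopologicalSpace X] [Finite ι] (θ : ι → C(X, ℝ))
    (S : Finset ι) : IsOpen (dominantSet θ S) := by
  simp only [dominantSet, Set.ofPred_forall, Set.ofPred_and]
  refine isOpen_iInter_of_finite fun s => isOpen_iInter_of_finite fun _ =>
    (isOpen_lt (by fun_prop) (by fun_prop)).inter ?_
  exact isOpen_iInter_of_finite fun t => isOpen_iInter_of_finite fun _ =>
    isOpen_lt (by fun_prop) (by fun_prop)

theorem disjoint_dominantSet {X ι : Type*} [TopologicalSpace X] (θ : ι → C(X, ℝ))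
    {S T : Finset ι} (hcard : S.card = T.card) (hne : S ≠ T) :
    Disjoint (dominantSet θ S) (dominantSet θ T) := by
  obtain ⟨s, hs, hsT⟩ := Finset.not_subset.1
    fun h => hne (Finset.eq_of_subset_of_card_le h hcard.ge)
  obtain ⟨t, ht, htS⟩ := Finset.not_subset.1
    fun h => hne (Finset.eq_of_subset_of_card_le h hcard.le).symm
  exact Set.disjoint_left.2 fun x hx hx' =>
    lt_asymm ((hx s hs).2 t htS) ((hx' t ht).2 s hsT)

theorem homotopicDistance_le {X Y : Type*} [TopologicalSpace X] [TopologicalSpace Y]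
    {f g : C(X, Y)} {n : ℕ} {U : Fin (n + 1) → Set X} (hU : ∀ j, IsOpen (U j))
    (hc : (⋃ j, U j) = Set.univ)
    (H : ∀ j, (f.restrict (U j)).Homotopic (g.restrict (U j))) :
    homotopicDistance f g ≤ n :=
  sInf_le ⟨n, ⟨U, hU, hc, H⟩, rfl⟩

theorem exists_cover_of_homotopicDistance_ne_top {X Y : Type*} [TopologicalSpace X]
    [TopologicalSpace Y] {f g : C(X, Y)} (h : homotopicDistance f g ≠ ⊤) :
    ∃ n : ℕ, (n : ℕ∞) = homotopicDistance f g ∧ ∃ U : Fin (n + 1) → Set X,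
      (∀ j, IsOpen (U j)) ∧ (⋃ j, U j) = Set.univ ∧
      ∀ j, (f.restrict (U j)).Homotopic (g.restrict (U j)) := by
  have hne := Set.nonempty_iff_ne_empty.2 fun he => h ((congrArg sInf he).trans sInf_empty)
  obtain ⟨n, hn, hn'⟩ := csInf_mem hne
  exact ⟨n, hn', hn⟩

/-- Triangle inequality: for maps defined on a normal space,
`D(f, h) ≤ D(f, g) + D(g, h)`. -/
theorem homotopicDistance_triangle {X Y : Type*} [TopologicalSpace X] [NormalSpace X]
    [TopologicalSpace Y] (f g h : C(X, Y)) :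
    homotopicDistance f h ≤ homotopicDistance f g + homotopicDistance g h := by
  classical
  by_cases h₁ : homotopicDistance f g = ⊤
  · simp [h₁]
  by_cases h₂ : homotopicDistance g h = ⊤
  · simp [h₂]
  obtain ⟨m, hm, U, hU, hUc, hUH⟩ := exists_cover_of_homotopicDistance_ne_top h₁
  obtain ⟨n, hn, V, hV, hVc, hVH⟩ := exists_cover_of_homotopicDistance_ne_top h₂
  obtain ⟨φ, hφ1, hφU, hφ⟩ := exists_continuous_subordinate_eq_one hU hUc
  obtain ⟨ψ, hψ1, hψV, hψ⟩ := exists_continuous_subordinate_eq_one hV hVc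
  let θ : Fin (m + 1) ⊕ Fin (n + 1) → C(X, ℝ) := Sum.elim φ ψ
  have hθ1 : ∀ s x, θ s x ≤ 1 := by
    rintro (i | j) x
    exacts [hφ1 i x, hψ1 j x]
  let I : ℕ → Type := fun k => {S : Finset (Fin (m + 1) ⊕ Fin (n + 1)) //
    S.card = k + 2 ∧ (∃ i, Sum.inl i ∈ S) ∧ ∃ j, Sum.inr j ∈ S}
  rw [← hm, ← hn, ← Nat.cast_add]
  refine homotopicDistance_le (U := fun k => ⋃ S : I k, dominantSet θ S.1)
    (fun k => isOpen_iUnion fun S => isOpen_dominantSet θ S.1) ?_ fun k => ?_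
  · refine Set.eq_univ_of_forall fun x => ?_
    let S := Finset.univ.filter fun s => θ s x = 1
    obtain ⟨i, hi⟩ := hφ x
    obtain ⟨j, hj⟩ := hψ x
    have hiS : Sum.inl i ∈ S := by simpa [S, θ] using hi
    have hjS : Sum.inr j ∈ S := by simpa [S, θ] using hj
    have hle : S.card ≤ (m + 1) + (n + 1) := by simpa using S.card_le_univ
    have hlt : 1 < S.card := Finset.one_lt_card.2 ⟨_, hiS, _, hjS, by simp⟩
    refine Set.mem_iUnion.2 ⟨⟨S.card - 2, by omega⟩,
      Set.mem_iUnion.2 ⟨⟨S, by simp only; omega, ⟨i, hiS⟩, j, hjS⟩, fun s hs => ?_⟩⟩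
    have hs1 : θ s x = 1 := (Finset.mem_filter.1 hs).2
    refine ⟨by simp [hs1], fun t ht => ?_⟩
    rw [hs1]
    exact (hθ1 t x).lt_of_ne fun h => ht (Finset.mem_filter.2 ⟨Finset.mem_univ _, h⟩)
  · refine homotopic_restrict_iUnion_of_disjoint (fun S => isOpen_dominantSet θ S.1)
      (fun S T hST => disjoint_dominantSet θ (S.2.1.trans T.2.1.symm)
        fun h => hST (Subtype.ext h)) ?_
    rintro ⟨S, -, ⟨i, hi⟩, j, hj⟩
    exact (homotopic_restrict_mono (fun x hx => hφU i x (hx _ hi).1) (hUH i)).trans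
      (homotopic_restrict_mono (fun x hx => hψV j x (hx _ hj).1) (hVH j))
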